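/- Let S be a (2,ω)-divisible Cu-semigroup satisfying (O5), (O6) and (O7), let x ∈ S, and let u' ∈ L_x. Then there exists a strongly soft element w ∈ S such that u' ≪ w ≤ x ≤ ∞w and λ(w) = λ(x) for every functional λ ∈ F(S). -/

import Mathlib

open Set

/-- The way-below relation: `x ≪ y` if for every increasing sequence with a
supremum dominating `y`, some term of the sequence dominates `x`. -/
def WayBelow {S : Type*} [Preorder S] (x y : S) : Prop :=
  ∀ z : ℕ → S, Monotone z → ∀ s : S, IsLUB (Set.range z) s → y ≤ s → ∃ m : ℕ, x ≤ z m

/-- A Cu-semigroup: a positively ordered commutative monoid satisfying (O1)-(O4). -/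
class CuSemigroup (S : Type*) extends AddCommMonoid S, PartialOrder S where
  zero_le : ∀ x : S, 0 ≤ x
  add_mono : ∀ {a b c d : S}, a ≤ b → c ≤ d → a + c ≤ b + d
  O1 : ∀ z : ℕ → S, Monotone z → ∃ s : S, IsLUB (Set.range z) s
  O2 : ∀ x : S, ∃ z : ℕ → S, (∀ n, WayBelow (z n) (z (n + 1))) ∧ IsLUB (Set.range z) x
  O3 : ∀ {x' x y' y : S}, WayBelow x' x → WayBelow y' y → WayBelow (x' + y') (x + y)
  O4 : ∀ (x y : ℕ → S), Monotone x → Monotone y → ∀ sx sy : S,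
      IsLUB (Set.range x) sx → IsLUB (Set.range y) sy →
      IsLUB (Set.range fun n => x n + y n) (sx + sy)

variable {S : Type*}

lemma CuSemigroup.nsmul_mono [CuSemigroup S] (x : S) : Monotone fun n : ℕ => n • x := by
  intro n m h
  obtain ⟨k, rfl⟩ := Nat.exists_eq_add_of_le h
  show n • x ≤ (n + k) • x
  rw [add_nsmul]
  calc n • x = n • x + 0 := by rw [add_zero]
    _ ≤ n • x + k • x := CuSemigroup.add_mono le_rfl (CuSemigroup.zero_le _)

/-- `infty x` is the supremum of the increasing sequence `n • x`, i.e. `∞x`. -/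
noncomputable def infty [CuSemigroup S] (x : S) : S :=
  (CuSemigroup.O1 (fun n : ℕ => n • x) (CuSemigroup.nsmul_mono x)).choose

lemma infty_isLUB [CuSemigroup S] (x : S) :
    IsLUB (Set.range fun n : ℕ => n • x) (infty x) :=
  (CuSemigroup.O1 (fun n : ℕ => n • x) (CuSemigroup.nsmul_mono x)).choose_spec

/-- An element is strongly soft if every `x' ≪ x` admits `t` with `x' + t ≪ x`
and `x' ≪ ∞t`. -/
def StronglySoft [CuSemigroup S] (x : S) : Prop :=
  ∀ x' : S, WayBelow x' x → ∃ t : S, WayBelow (x' + t) x ∧ WayBelow x' (infty t)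

def SatisfiesO5 (S : Type*) [CuSemigroup S] : Prop :=
  ∀ x' x y' y z : S, WayBelow x' x → WayBelow y' y → x + y ≤ z →
    ∃ c : S, WayBelow y' c ∧ x' + c ≤ z ∧ z ≤ x + c

def SatisfiesO6 (S : Type*) [CuSemigroup S] : Prop :=
  ∀ x' x y z : S, WayBelow x' x → WayBelow x (y + z) →
    ∃ v w : S, v ≤ x ∧ v ≤ y ∧ w ≤ x ∧ w ≤ z ∧ x' ≤ v + w

def SatisfiesO7 (S : Type*) [CuSemigroup S] : Prop :=
  ∀ x' x y' y w : S, WayBelow x' x → x ≤ w → WayBelow y' y → y ≤ w →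
    ∃ z : S, WayBelow x' z ∧ WayBelow y' z ∧ z ≤ w ∧ z ≤ x + y

def TwoOmegaDivisible (S : Type*) [CuSemigroup S] : Prop :=
  ∀ x' x : S, WayBelow x' x → ∃ y : S, 2 • y ≤ x ∧ x' ≤ infty y

def WeaklyCancellative (S : Type*) [CuSemigroup S] : Prop :=
  ∀ x y z : S, WayBelow (x + z) (y + z) → WayBelow x y

def Separative (S : Type*) [CuSemigroup S] : Prop :=
  ∀ x y t : S, WayBelow (x + t) (y + t) → WayBelow t (infty x) → WayBelow t (infty y) →
    WayBelow x y

def LeftSoftSeparative (S : Type*) [CuSemigroup S] : Prop :=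
  ∀ x y t : S, StronglySoft x → WayBelow (x + t) (y + t) → WayBelow t (infty x) →
    WayBelow t (infty y) → WayBelow x y

def AlmostUnperforated (S : Type*) [CuSemigroup S] : Prop :=
  ∀ x y : S, (∃ n : ℕ, 1 ≤ n ∧ (n + 1) • x ≤ n • y) → x ≤ y

def CountablyBased (S : Type*) [CuSemigroup S] : Prop :=
  ∃ D : Set S, D.Countable ∧
    ∀ x : S, ∃ z : ℕ → S, Monotone z ∧ (∀ n, z n ∈ D) ∧ IsLUB (Set.range z) x

/-- `Lset x` is the set `L_x = { u' : u' ≪ u ≪ x for some strongly soft u }`. -/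
def Lset [CuSemigroup S] (x : S) : Set S :=
  { u' | ∃ u : S, StronglySoft u ∧ WayBelow u' u ∧ WayBelow u x }

/-- A functional on a Cu-semigroup: a monoid morphism to `[0,∞]` preserving order
and suprema of increasing sequences. -/
structure CuFunctional (S : Type*) [CuSemigroup S] where
  toFun : S → ENNReal
  map_zero : toFun 0 = 0
  map_add : ∀ x y : S, toFun (x + y) = toFun x + toFun y
  mono : ∀ x y : S, x ≤ y → toFun x ≤ toFun y
  map_sup : ∀ z : ℕ → S, Monotone z → ∀ s : S, IsLUB (Set.range z) s →
    toFun s = ⨆ n, toFun (z n)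

/-- Predicate version: `f : S → [0,∞]` is a functional on `S`. -/
def IsCuFunctional [CuSemigroup S] (f : S → ENNReal) : Prop :=
  f 0 = 0 ∧ (∀ x y : S, f (x + y) = f x + f y) ∧ (∀ x y : S, x ≤ y → f x ≤ f y) ∧
  (∀ z : ℕ → S, Monotone z → ∀ s : S, IsLUB (Set.range z) s → f s = ⨆ n, f (z n))

/-- Least upper bound of `A` computed within the subset `T`. -/
def IsLUBIn [CuSemigroup S] (T : Set S) (A : Set S) (s : S) : Prop :=
  s ∈ T ∧ s ∈ upperBounds A ∧ ∀ b ∈ T, b ∈ upperBounds A → s ≤ b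

/-- The way-below relation computed within the subset `T`. -/
def WayBelowIn [CuSemigroup S] (T : Set S) (x y : S) : Prop :=
  ∀ z : ℕ → S, Monotone z → (∀ n, z n ∈ T) → ∀ s : S, IsLUBIn T (Set.range z) s → y ≤ s →
    ∃ m : ℕ, x ≤ z m

/-- `T` is a sub-Cu-semigroup of `S`: a submonoid which is itself a Cu-semigroup
for the inherited order, such that the inclusion preserves suprema of increasing
sequences and the way-below relation. -/
structure IsSubCuSemigroup [CuSemigroup S] (T : Set S) : Prop where
  zero_mem : (0 : S) ∈ T
  add_mem : ∀ {x y : S}, x ∈ T → y ∈ T → x + y ∈ T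
  o1 : ∀ z : ℕ → S, Monotone z → (∀ n, z n ∈ T) → ∃ s : S, IsLUBIn T (Set.range z) s
  o2 : ∀ x ∈ T, ∃ z : ℕ → S, (∀ n, z n ∈ T) ∧ (∀ n, WayBelowIn T (z n) (z (n + 1))) ∧
        IsLUBIn T (Set.range z) x
  o3 : ∀ {x' x y' y : S}, x' ∈ T → x ∈ T → y' ∈ T → y ∈ T →
        WayBelowIn T x' x → WayBelowIn T y' y → WayBelowIn T (x' + y') (x + y)
  o4 : ∀ (x y : ℕ → S), Monotone x → Monotone y → (∀ n, x n ∈ T) → (∀ n, y n ∈ T) →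
        ∀ sx sy : S, IsLUBIn T (Set.range x) sx → IsLUBIn T (Set.range y) sy →
        IsLUBIn T (Set.range fun n => x n + y n) (sx + sy)
  incl_sup : ∀ z : ℕ → S, Monotone z → (∀ n, z n ∈ T) → ∀ s : S,
        IsLUBIn T (Set.range z) s → IsLUB (Set.range z) s
  incl_wayBelow : ∀ {x y : S}, x ∈ T → y ∈ T → WayBelowIn T x y → WayBelow x y

def SatisfiesO5In [CuSemigroup S] (T : Set S) : Prop :=
  ∀ x' x y' y z : S, x' ∈ T → x ∈ T → y' ∈ T → y ∈ T → z ∈ T →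
    WayBelowIn T x' x → WayBelowIn T y' y → x + y ≤ z →
    ∃ c ∈ T, WayBelowIn T y' c ∧ x' + c ≤ z ∧ z ≤ x + c

def SatisfiesO6In [CuSemigroup S] (T : Set S) : Prop :=
  ∀ x' x y z : S, x' ∈ T → x ∈ T → y ∈ T → z ∈ T →
    WayBelowIn T x' x → WayBelowIn T x (y + z) →
    ∃ v ∈ T, ∃ w ∈ T, v ≤ x ∧ v ≤ y ∧ w ≤ x ∧ w ≤ z ∧ x' ≤ v + w

def SatisfiesO7In [CuSemigroup S] (T : Set S) : Prop :=
  ∀ x' x y' y w : S, x' ∈ T → x ∈ T → y' ∈ T → y ∈ T → w ∈ T →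
    WayBelowIn T x' x → x ≤ w → WayBelowIn T y' y → y ≤ w →
    ∃ z ∈ T, WayBelowIn T x' z ∧ WayBelowIn T y' z ∧ z ≤ w ∧ z ≤ x + y

/-- `f` is a functional on the sub-Cu-semigroup `T` (values off `T` are irrelevant). -/
def IsFunctionalOn [CuSemigroup S] (T : Set S) (f : S → ENNReal) : Prop :=
  f 0 = 0 ∧
  (∀ x ∈ T, ∀ y ∈ T, f (x + y) = f x + f y) ∧
  (∀ x ∈ T, ∀ y ∈ T, x ≤ y → f x ≤ f y) ∧
  (∀ z : ℕ → S, Monotone z → (∀ n, z n ∈ T) → ∀ s : S, IsLUBIn T (Set.range z) s →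
    f s = ⨆ n, f (z n))

/-- An element is full if `x ≤ ∞e` for every `x`. -/
def IsFull [CuSemigroup S] (e : S) : Prop := ∀ x : S, x ≤ infty e

/-- Condition (R1) for `r`: comparison of `x` with `y` whenever
`λ(x) + r·λ(e) ≤ λ(y)` for all functionals. -/
def SatisfiesR1 (S : Type*) [CuSemigroup S] (e : S) (r : NNReal) : Prop :=
  ∀ x y : S,
    (∀ lam : CuFunctional S, lam.toFun x + (r : ENNReal) * lam.toFun e ≤ lam.toFun y) → x ≤ y

/-- The radius of comparison of `(S, e)`. -/
noncomputable def rc (S : Type*) [CuSemigroup S] (e : S) : ENNReal :=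
  ⨅ r ∈ {r : NNReal | 0 < r ∧ SatisfiesR1 S e r}, (r : ENNReal)

/-- Condition (R1) for the sub-Cu-semigroup `T`. -/
def SatisfiesR1On [CuSemigroup S] (T : Set S) (e : S) (r : NNReal) : Prop :=
  ∀ x ∈ T, ∀ y ∈ T,
    (∀ f : S → ENNReal, IsFunctionalOn T f → f x + (r : ENNReal) * f e ≤ f y) → x ≤ y

/-- The radius of comparison of `(T, e)` for a sub-Cu-semigroup `T ⊆ S`. -/
noncomputable def rcOn [CuSemigroup S] (T : Set S) (e : S) : ENNReal :=
  ⨅ r ∈ {r : NNReal | 0 < r ∧ SatisfiesR1On T e r}, (r : ENNReal)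

/-- `dim S ≤ n` in the sense of covering dimension of Cu-semigroups. -/
def DimLe (S : Type*) [CuSemigroup S] (n : ℕ) : Prop :=
  ∀ (x' x : S) (r : ℕ) (y : Fin r → S), WayBelow x' x → WayBelow x (∑ j, y j) →
    ∃ z : Fin r → Fin (n + 1) → S,
      (∀ j k, WayBelow (z j k) (y j)) ∧
      WayBelow x' (∑ j, ∑ k, z j k) ∧
      (∀ k, WayBelow (∑ j, z j k) x)

/-- The covering dimension of a Cu-semigroup, in `ℕ ∪ {∞}`. -/
noncomputable def cuDim (S : Type*) [CuSemigroup S] : ℕ∞ :=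
  ⨅ n ∈ {n : ℕ | DimLe S n}, (n : ℕ∞)

/-- `dim T ≤ n` for a sub-Cu-semigroup `T ⊆ S`. -/
def DimLeOn [CuSemigroup S] (T : Set S) (n : ℕ) : Prop :=
  ∀ (x' x : S), x' ∈ T → x ∈ T → ∀ (r : ℕ) (y : Fin r → S), (∀ j, y j ∈ T) →
    WayBelowIn T x' x → WayBelowIn T x (∑ j, y j) →
    ∃ z : Fin r → Fin (n + 1) → S,
      (∀ j k, z j k ∈ T) ∧
      (∀ j k, WayBelowIn T (z j k) (y j)) ∧
      WayBelowIn T x' (∑ j, ∑ k, z j k) ∧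
      (∀ k, WayBelowIn T (∑ j, z j k) x)

/-- The covering dimension of a sub-Cu-semigroup `T ⊆ S`. -/
noncomputable def cuDimOn [CuSemigroup S] (T : Set S) : ℕ∞ :=
  ⨅ n ∈ {n : ℕ | DimLeOn T n}, (n : ℕ∞)

section Auxiliary

variable [CuSemigroup S] {a b c d : S}

instance CuSemigroup.isOrderedAddMonoid : IsOrderedAddMonoid S where
  add_le_add_left _ _ h _ := CuSemigroup.add_mono h le_rfl

lemma CuSemigroup.le_add_right (a b : S) : a ≤ a + b := by
  simpa using add_le_add_right (CuSemigroup.zero_le b) a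

lemma CuSemigroup.le_add_left (a b : S) : a ≤ b + a := by
  rw [add_comm]
  exact CuSemigroup.le_add_right a b

lemma WayBelow.le (h : WayBelow a b) : a ≤ b := by
  obtain ⟨_, hm⟩ := h (fun _ => b) monotone_const b (by simp) le_rfl
  exact hm

lemma WayBelow.trans_le (h : WayBelow a b) (h' : b ≤ c) : WayBelow a c :=
  fun z hz s hs hc => h z hz s hs (h'.trans hc)

lemma WayBelow.le_trans (h' : a ≤ b) (h : WayBelow b c) : WayBelow a c := by
  intro z hz s hs hc
  obtain ⟨m, hm⟩ := h z hz s hs hc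
  exact ⟨m, h'.trans hm⟩

lemma WayBelow.zero (a : S) : WayBelow 0 a :=
  fun _ _ _ _ _ => ⟨0, CuSemigroup.zero_le _⟩

lemma WayBelow.nsmul (n : ℕ) (h : WayBelow a b) : WayBelow (n • a) (n • b) := by
  induction n with
  | zero => simpa using WayBelow.zero (0 : S)
  | succ n ih => simpa only [succ_nsmul] using CuSemigroup.O3 ih h

/-- Every element is the supremum of an increasing sequence of elements way below it. -/
lemma CuSemigroup.exists_seq (a : S) :
    ∃ z : ℕ → S, Monotone z ∧ (∀ n, WayBelow (z n) a) ∧ IsLUB (Set.range z) a := by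
  obtain ⟨z, hz, hs⟩ := CuSemigroup.O2 a
  exact ⟨z, monotone_nat_of_le_succ fun n => (hz n).le,
    fun n => (hz n).trans_le (hs.1 ⟨n + 1, rfl⟩), hs⟩

lemma WayBelow.exists_between (h : WayBelow a c) : ∃ b, WayBelow a b ∧ WayBelow b c := by
  obtain ⟨z, hz, hs⟩ := CuSemigroup.O2 c
  obtain ⟨m, hm⟩ := h z (monotone_nat_of_le_succ fun n => (hz n).le) c hs le_rfl
  exact ⟨z (m + 1), .le_trans hm (hz m), (hz (m + 1)).trans_le (hs.1 ⟨m + 2, rfl⟩)⟩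

lemma WayBelow.exists_common (h : WayBelow a c) (h' : WayBelow b c) :
    ∃ d, a ≤ d ∧ b ≤ d ∧ WayBelow d c := by
  obtain ⟨z, hz, hzc, hs⟩ := CuSemigroup.exists_seq c
  obtain ⟨m, hm⟩ := h z hz c hs le_rfl
  obtain ⟨n, hn⟩ := h' z hz c hs le_rfl
  exact ⟨z (max m n), hm.trans (hz (le_max_left _ _)), hn.trans (hz (le_max_right _ _)), hzc _⟩

lemma WayBelow.exists_add (h : WayBelow a (b + c)) :
    ∃ b' c', WayBelow b' b ∧ WayBelow c' c ∧ a ≤ b' + c' := by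
  obtain ⟨y, hy, hyb, hys⟩ := CuSemigroup.exists_seq b
  obtain ⟨z, hz, hzc, hzs⟩ := CuSemigroup.exists_seq c
  obtain ⟨m, hm⟩ := h _ (hy.add hz) _ (CuSemigroup.O4 y z hy hz b c hys hzs) le_rfl
  exact ⟨y m, z m, hyb m, hzc m, hm⟩

lemma WayBelow.exists_nsmul {m : ℕ} (h : WayBelow a (m • b)) :
    ∃ b', WayBelow b' b ∧ a ≤ m • b' := by
  induction m generalizing a with
  | zero => exact ⟨0, .zero b, by simpa using h.le⟩
  | succ m ih =>
    rw [succ_nsmul] at h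
    obtain ⟨p, q, hp, hq, ha⟩ := h.exists_add
    obtain ⟨p', hp', hpp⟩ := ih hp
    obtain ⟨r, hpr, hqr, hr⟩ := hp'.exists_common hq
    refine ⟨r, hr, ha.trans ?_⟩
    rw [succ_nsmul]
    exact add_le_add (hpp.trans (nsmul_le_nsmul_right hpr m)) hqr

lemma nsmul_le_infty (n : ℕ) (a : S) : n • a ≤ infty a :=
  (infty_isLUB a).1 ⟨n, rfl⟩

lemma le_infty (a : S) : a ≤ infty a := by
  simpa using nsmul_le_infty 1 a

lemma infty_add_infty_le (a : S) : infty a + infty a ≤ infty a := by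
  have h := CuSemigroup.O4 _ _ (CuSemigroup.nsmul_mono a) (CuSemigroup.nsmul_mono a) _ _
    (infty_isLUB a) (infty_isLUB a)
  refine h.2 ?_
  rintro _ ⟨n, rfl⟩
  simpa only [← add_nsmul] using nsmul_le_infty (n + n) a

lemma add_le_infty (ha : a ≤ infty c) (hb : b ≤ infty c) : a + b ≤ infty c :=
  (add_le_add ha hb).trans (infty_add_infty_le c)

lemma nsmul_le_infty_of_le (n : ℕ) (h : a ≤ infty b) : n • a ≤ infty b := by
  induction n with
  | zero => simpa using CuSemigroup.zero_le (infty b)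
  | succ n ih => simpa only [succ_nsmul] using add_le_infty ih h

lemma infty_le_infty (h : a ≤ infty b) : infty a ≤ infty b := by
  refine (infty_isLUB a).2 ?_
  rintro _ ⟨n, rfl⟩
  exact nsmul_le_infty_of_le n h

lemma le_infty_trans (h : a ≤ infty b) (h' : b ≤ infty c) : a ≤ infty c :=
  h.trans (infty_le_infty h')

lemma WayBelow.exists_le_nsmul (h : WayBelow a (infty b)) : ∃ m : ℕ, a ≤ m • b :=
  h _ (CuSemigroup.nsmul_mono b) _ (infty_isLUB b) le_rfl

lemma WayBelow.exists_nsmul_infty (h : WayBelow a (infty b)) :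
    ∃ b', WayBelow b' b ∧ ∃ m : ℕ, WayBelow a (m • b') := by
  obtain ⟨a₁, ha₁, ha₂⟩ := h.exists_between
  obtain ⟨a₂, ha₂, ha₃⟩ := ha₂.exists_between
  obtain ⟨m, hm⟩ := ha₃.exists_le_nsmul
  obtain ⟨b', hb', hab⟩ := (ha₂.trans_le hm).exists_nsmul
  exact ⟨b', hb', m, ha₁.trans_le hab⟩

lemma WayBelow.exists_le_infty (h : WayBelow a (infty b)) :
    ∃ b', WayBelow b' b ∧ a ≤ infty b' := by
  obtain ⟨b', hb', m, hm⟩ := h.exists_nsmul_infty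
  exact ⟨b', hb', hm.le.trans (nsmul_le_infty m b')⟩

/-- Adding a strongly soft element that generates a larger ideal yields a strongly soft element. -/
lemma StronglySoft.add_of_le_infty {s : S} (hs : StronglySoft s) (hc : c ≤ infty s) :
    StronglySoft (c + s) := by
  intro a ha
  obtain ⟨a₁, haa, ha₁⟩ := ha.exists_between
  obtain ⟨c', s', hc', hs', h⟩ := ha₁.exists_add
  obtain ⟨s₁, hs₁, hcs⟩ := (hc'.trans_le hc).exists_le_infty
  obtain ⟨r, hsr, hsr₁, hr⟩ := hs'.exists_common hs₁
  obtain ⟨t, ht, hrt⟩ := hs r hr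
  have hrt' := hrt.le
  refine ⟨t, .le_trans ?_ (CuSemigroup.O3 hc' ht), haa.trans_le (h.trans (add_le_infty ?_ ?_))⟩
  · rw [← add_assoc]
    gcongr
    exact haa.le.trans (h.trans (by gcongr))
  · exact le_infty_trans hcs (hsr₁.trans hrt')
  · exact hsr.trans hrt'

lemma TwoOmegaDivisible.exists_nsmul_le (hdiv : TwoOmegaDivisible S) (n : ℕ)
    (h : WayBelow a b) : ∃ y : S, n • y ≤ b ∧ a ≤ infty y := by
  suffices H : ∀ k : ℕ, ∀ a b : S, WayBelow a b → ∃ y : S, 2 ^ k • y ≤ b ∧ a ≤ infty y by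
    obtain ⟨y, hy, hay⟩ := H n a b h
    exact ⟨y, (CuSemigroup.nsmul_mono y Nat.lt_two_pow_self.le).trans hy, hay⟩
  intro k
  induction k with
  | zero => exact fun a b h => ⟨b, by simp, h.le.trans (le_infty b)⟩
  | succ k ih =>
    intro a b h
    obtain ⟨a₁, ha₁, hb⟩ := h.exists_between
    obtain ⟨y, hy, hay⟩ := hdiv a₁ b hb
    obtain ⟨y', hy', hay'⟩ := (ha₁.trans_le hay).exists_le_infty
    obtain ⟨r, hr, hyr⟩ := ih y' y hy'
    refine ⟨r, ?_, le_infty_trans hay' hyr⟩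
    rw [pow_succ, mul_comm, mul_nsmul']
    exact (nsmul_le_nsmul_right hr 2).trans hy

/-- Below every element there is a strongly soft element generating almost the same ideal. -/
lemma TwoOmegaDivisible.exists_stronglySoft_le (hdiv : TwoOmegaDivisible S)
    (h : WayBelow a b) : ∃ s : S, StronglySoft s ∧ s ≤ b ∧ a ≤ infty s := by
  have step : ∀ p : {p : S × S // WayBelow p.1 p.2}, ∃ q : {p : S × S // WayBelow p.1 p.2},
      2 • q.1.2 ≤ p.1.2 ∧ p.1.1 ≤ infty q.1.1 := by
    rintro ⟨⟨y', y⟩, hy⟩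
    obtain ⟨y₁, hy₁, hyy⟩ := hy.exists_between
    obtain ⟨r, hr, hyr⟩ := hdiv y₁ y hyy
    obtain ⟨r', hr', hyr'⟩ := (hy₁.trans_le hyr).exists_le_infty
    exact ⟨⟨(r', r), hr'⟩, hr, hyr'⟩
  choose f hf₁ hf₂ using step
  let p : ℕ → {p : S × S // WayBelow p.1 p.2} := fun n => f^[n] ⟨(a, b), h⟩
  have hp : ∀ n, p (n + 1) = f (p n) := fun n => Function.iterate_succ_apply' f n _
  have hle : ∀ n, 2 • (p (n + 1)).1.2 ≤ (p n).1.2 := fun n => hp n ▸ hf₁ (p n)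
  have hgen : ∀ n, (p n).1.1 ≤ infty (p (n + 1)).1.1 := fun n => hp n ▸ hf₂ (p n)
  let P : ℕ → S := fun n => ∑ i ∈ Finset.range n, (p (i + 1)).1.1
  have hPsucc : ∀ n, P (n + 1) = P n + (p (n + 1)).1.1 := fun n => Finset.sum_range_succ _ n
  have hPmono : Monotone P := monotone_nat_of_le_succ fun n => by
    rw [hPsucc]
    exact CuSemigroup.le_add_right _ _
  have hPle : ∀ n, P n + (p n).1.2 ≤ b := by
    intro n
    induction n with
    | zero => simp [P, p]
    | succ n ih =>
      refine le_trans ?_ ih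
      rw [hPsucc, add_assoc]
      refine add_le_add_right (le_trans ?_ (hle n)) _
      rw [two_nsmul]
      exact add_le_add_left (p (n + 1)).2.le _
  have hPgen : ∀ n, P n ≤ infty (p (n + 1)).1.1 := by
    intro n
    induction n with
    | zero => simpa [P] using CuSemigroup.zero_le _
    | succ n ih =>
      rw [hPsucc]
      exact le_infty_trans (add_le_infty ih (le_infty _)) (hgen (n + 1))
  obtain ⟨s, hs⟩ := CuSemigroup.O1 P hPmono
  have hPs : ∀ n, P n ≤ s := fun n => hs.1 ⟨n, rfl⟩
  refine ⟨s, ?_, hs.2 ?_, ?_⟩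
  · intro x hx
    obtain ⟨x₁, hxx, hx₁⟩ := hx.exists_between
    obtain ⟨n, hn⟩ := hx₁ P hPmono s hs le_rfl
    obtain ⟨t, ht, m, hm⟩ := (hxx.trans_le (hn.trans (hPgen n))).exists_nsmul_infty
    refine ⟨t, (CuSemigroup.O3 hxx ht).trans_le ?_, hm.trans_le (nsmul_le_infty m t)⟩
    calc x₁ + (p (n + 1)).1.1 ≤ P n + (p (n + 1)).1.1 := by gcongr
      _ = P (n + 1) := (hPsucc n).symm
      _ ≤ s := hPs _
  · rintro _ ⟨n, rfl⟩
    exact (CuSemigroup.le_add_right _ _).trans (hPle n)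
  · refine le_infty_trans (hgen 0) (le_trans ?_ (le_infty s))
    simpa [P] using hPs 1

/-- If `a₁ ≤ m • t`, then some part of `t` lies in the ideal of `a₁` and has `m`-fold multiple
above any given `a ≪ a₁`. -/
lemma SatisfiesO7.exists_le_of_le_nsmul (hO7 : SatisfiesO7 S) (hO6 : SatisfiesO6 S)
    {a a₁ t : S} {m : ℕ} (ha : WayBelow a a₁) (hm : a₁ ≤ m • t) :
    ∃ N : ℕ, ∃ b : S, b ≤ t ∧ b ≤ (N + 1) • a₁ ∧ a ≤ m • b := by
  induction m generalizing a a₁ with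
  | zero =>
    exact ⟨0, 0, CuSemigroup.zero_le _, CuSemigroup.zero_le _, by simpa using ha.le.trans hm⟩
  | succ m ih =>
    obtain ⟨a₂, haa₂, ha₂⟩ := ha.exists_between
    obtain ⟨a₃, ha₂₃, ha₃⟩ := ha₂.exists_between
    rw [succ_nsmul] at hm
    obtain ⟨v, w, hva, hvt, hwa, hwt, hvw⟩ := hO6 a₂ a₃ _ _ ha₂₃ (ha₃.trans_le hm)
    obtain ⟨v', w', hv', hw', hvw'⟩ := (haa₂.trans_le hvw).exists_add
    obtain ⟨v₁, hv₁, hv₁v⟩ := hv'.exists_between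
    obtain ⟨N, q, hqt, hqN, hvq⟩ := ih hv₁v hvt
    obtain ⟨q', hq', hvq'⟩ := (hv₁.trans_le hvq).exists_nsmul
    obtain ⟨b, hb₁, hb₂, hbt, hbq⟩ := hO7 q' q w' w t hq' hqt hw' hwt
    refine ⟨N + 1, b, hbt, hbq.trans ?_, hvw'.trans ?_⟩
    · rw [succ_nsmul]
      refine add_le_add (hqN.trans (nsmul_le_nsmul_right (hva.trans ha₃.le) _)) (hwa.trans ha₃.le)
    · rw [succ_nsmul]
      exact add_le_add (hvq'.trans (nsmul_le_nsmul_right hb₁.le m)) hb₂.le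

/-- A strongly soft element below `x` can be enlarged to generate almost the same ideal as `x`. -/
lemma StronglySoft.exists_generating (hdiv : TwoOmegaDivisible S) (hO5 : SatisfiesO5 S)
    {u u' x x₀ : S} (hu : StronglySoft u) (huu : WayBelow u' u) (hux : u ≤ x)
    (hx₀ : WayBelow x₀ x) :
    ∃ w w' : S, StronglySoft w ∧ w ≤ x ∧ WayBelow w' w ∧ u' ≤ w' ∧ x₀ ≤ infty w' := by
  obtain ⟨u₁, huu₁, hu₁⟩ := huu.exists_between
  obtain ⟨u₂, huu₂, hu₂⟩ := hu₁.exists_between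
  obtain ⟨x₁, hx₀₁, hx₁⟩ := hx₀.exists_between
  obtain ⟨t, htu, hut⟩ := hu u₂ hu₂
  obtain ⟨t', ht', hut'⟩ := hut.exists_le_infty
  obtain ⟨c, htc, hcx, hxc⟩ := hO5 u₁ u₂ t' t x huu₂ ht' (htu.le.trans hux)
  have hxc' : x ≤ infty c :=
    hxc.trans (add_le_infty (le_infty_trans hut' (htc.le.trans (le_infty c))) (le_infty c))
  obtain ⟨c₁, hc₁, hxc₁⟩ := (hx₁.trans_le hxc').exists_le_infty
  obtain ⟨c₂, htc₂, hc₁₂, hc₂⟩ := htc.exists_common hc₁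
  obtain ⟨s, hs, hsc, hcs⟩ := hdiv.exists_stronglySoft_le hc₂
  have hus : u₁ ≤ infty s :=
    huu₂.le.trans (le_infty_trans hut' (htc₂.trans hcs))
  have hxs : x₁ ≤ infty (u₁ + s) :=
    le_infty_trans hxc₁ ((hc₁₂.trans hcs).trans
      (infty_le_infty ((CuSemigroup.le_add_left s u₁).trans (le_infty _))))
  obtain ⟨w₁, hw₁, hxw₁⟩ := (hx₀₁.trans_le hxs).exists_le_infty
  obtain ⟨w', huw', hww', hw'⟩ :=
    (huu₁.trans_le (CuSemigroup.le_add_right u₁ s)).exists_common hw₁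
  exact ⟨u₁ + s, w', hs.add_of_le_infty hus, (add_le_add_right hsc u₁).trans hcx, hw', huw',
    le_infty_trans hxw₁ (hww'.trans (le_infty w'))⟩

/-- A strongly soft element below `x` generating almost the same ideal can be enlarged to one of
almost the same rank as `x`. -/
lemma StronglySoft.exists_rank_approx (hdiv : TwoOmegaDivisible S)
    (hO5 : SatisfiesO5 S) (hO6 : SatisfiesO6 S) (hO7 : SatisfiesO7 S)
    {u u' x x₀ x₁ : S} (hu : StronglySoft u) (huu : WayBelow u' u) (hux : u ≤ x)
    (hx₀ : WayBelow x₀ x₁) (hx₁ : WayBelow x₁ x) (hxu : x₁ ≤ infty u') (n : ℕ) :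
    ∃ w : S, StronglySoft w ∧ w ≤ x ∧ WayBelow u' w ∧
      ∃ N : ℕ, (n * (N + 1)) • x₀ ≤ ((n + 1) * (N + 1)) • w := by
  obtain ⟨u₁, huu₁, hu₁⟩ := huu.exists_between
  obtain ⟨u₂, hu₁₂, hu₂⟩ := hu₁.exists_between
  obtain ⟨u₃, hu₂₃, hu₃⟩ := hu₂.exists_between
  obtain ⟨u₄, hu₃₄, hu₄⟩ := hu₃.exists_between
  obtain ⟨u₅, hu₄₅, hu₅⟩ := hu₄.exists_between
  obtain ⟨t, htu, hut⟩ := hu u₅ hu₅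
  obtain ⟨m, hm⟩ := hut.exists_le_nsmul
  obtain ⟨N, b, hbt, hbN, hub⟩ := hO7.exists_le_of_le_nsmul hO6 hu₃₄ (hu₄₅.le.trans hm)
  obtain ⟨b', hb', hub'⟩ := (hu₂₃.trans_le hub).exists_nsmul
  obtain ⟨y, hyb, hby⟩ := hdiv.exists_nsmul_le (n * (N + 1) + 1) hb'
  have huy : u₂ ≤ infty y := hub'.trans (nsmul_le_infty_of_le m hby)
  obtain ⟨y₁, hy₁, huy₁⟩ := (hu₁₂.trans_le huy).exists_le_infty
  obtain ⟨y₂, hy₁₂, hy₂⟩ := hy₁.exists_between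
  have hyb' : y ≤ b :=
    le_trans (by simpa using CuSemigroup.nsmul_mono y (Nat.le_add_left 1 _)) hyb
  have hyNu : (n * (N + 1)) • y ≤ (N + 1) • u₄ :=
    (CuSemigroup.nsmul_mono y (Nat.le_succ _)).trans (hyb.trans hbN)
  have hyux : y + u₅ ≤ x := by
    rw [add_comm]
    exact (add_le_add_right (hyb'.trans hbt) u₅).trans (htu.le.trans hux)
  obtain ⟨e, hue, hyex, hxye⟩ := hO5 y₂ y u₄ u₅ x hy₂ hu₄₅ hyux
  obtain ⟨x₂, hx₀₂, hx₂⟩ := hx₀.exists_between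
  obtain ⟨v, w, hvx, hvy, hwx, hwe, hvw⟩ := hO6 x₂ x₁ y e hx₂ (hx₁.trans_le hxye)
  obtain ⟨v', w', hv', hw', hvw'⟩ := (hx₀₂.trans_le hvw).exists_add
  obtain ⟨v₁, hv₁, hv₁v⟩ := hv'.exists_between
  have hvN : (n * (N + 1)) • v ≤ (N + 1) • e :=
    (nsmul_le_nsmul_right hvy _).trans (hyNu.trans (nsmul_le_nsmul_right hue.le _))
  obtain ⟨M, q, hqe, hqM, hvq⟩ :=
    hO7.exists_le_of_le_nsmul hO6 (hv₁v.nsmul (n * (N + 1))) hvN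
  obtain ⟨q', hq', hvq'⟩ := ((hv₁.nsmul _).trans_le hvq).exists_nsmul
  obtain ⟨z₁, hqz₁, hwz₁, hz₁e, hz₁⟩ := hO7 q' q w' w e hq' hqe hw' hwe
  obtain ⟨z₁', hqz₁', hwz₁', hz₁'⟩ := hqz₁.exists_common hwz₁
  have hu₁e : u₁ ≤ e := (hu₁₂.le.trans (hu₂₃.le.trans hu₃₄.le)).trans hue.le
  obtain ⟨z, hz₁z, huz, hze, hz⟩ := hO7 z₁' z₁ u' u₁ e hz₁' hz₁e huu₁ hu₁e
  have hxy₁ : x₁ ≤ infty y₁ := le_infty_trans hxu (huu₁.le.trans huy₁)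
  have hqy₁ : q ≤ infty y₁ :=
    hqM.trans (nsmul_le_infty_of_le _ (nsmul_le_infty_of_le _ (hvx.trans hxy₁)))
  have hzy₁ : z ≤ infty y₁ :=
    hz.trans (add_le_infty (hz₁.trans (add_le_infty hqy₁ (hwx.trans hxy₁))) huy₁)
  obtain ⟨s, hs, hsy, hys⟩ := hdiv.exists_stronglySoft_le hy₁₂
  have hzs : z ≤ z + s := CuSemigroup.le_add_right z s
  refine ⟨z + s, hs.add_of_le_infty (le_infty_trans hzy₁ hys), ?_, huz.trans_le hzs, N, ?_⟩
  · rw [add_comm]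
    exact (add_le_add hsy hze).trans hyex
  · calc (n * (N + 1)) • x₀ ≤ (n * (N + 1)) • v' + (n * (N + 1)) • w' := by
          rw [← nsmul_add]
          exact nsmul_le_nsmul_right hvw' _
      _ ≤ (N + 1) • z + (n * (N + 1)) • z :=
          add_le_add (hvq'.trans (nsmul_le_nsmul_right (hqz₁'.trans hz₁z.le) _))
            (nsmul_le_nsmul_right (hwz₁'.trans hz₁z.le) _)
      _ = ((n + 1) * (N + 1)) • z := by
          rw [← add_nsmul]
          congr 1
          ring
      _ ≤ ((n + 1) * (N + 1)) • (z + s) := nsmul_le_nsmul_right hzs _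

/-- Members of `Lset x` can be enlarged within `Lset x` to absorb a witness of softness and to
approximate the rank of `x`. -/
lemma exists_mem_Lset_rank_approx (hdiv : TwoOmegaDivisible S)
    (hO5 : SatisfiesO5 S) (hO6 : SatisfiesO6 S) (hO7 : SatisfiesO7 S)
    {x w x₀ : S} (hw : w ∈ Lset x) (hx₀ : WayBelow x₀ x) (n : ℕ) :
    ∃ w₁ ∈ Lset x, WayBelow w w₁ ∧ (∃ t, w + t ≤ w₁ ∧ WayBelow w (infty t)) ∧
      x₀ ≤ infty w₁ ∧ ∃ N : ℕ, (n * (N + 1)) • x₀ ≤ ((n + 1) * (N + 1)) • w₁ := by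
  obtain ⟨v, hv, hwv, hvx⟩ := hw
  obtain ⟨t, ht, hwt⟩ := hv w hwv
  obtain ⟨r, hvr, hr⟩ := hvx.exists_between
  obtain ⟨x₁, hx₀₁, hx₁⟩ := hx₀.exists_between
  obtain ⟨y, hry, hxy, hy⟩ := hr.exists_common hx₁
  obtain ⟨y', hyy', hy'⟩ := hy.exists_between
  have hx₀y : WayBelow x₀ y := hx₀₁.trans_le hxy
  obtain ⟨x₂, hx₀₂, hx₂⟩ := hx₀y.exists_between
  obtain ⟨x₃, hx₂₃, hx₃⟩ := hx₂.exists_between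
  obtain ⟨p, p', hp, hpy, hpp, hwp, hxp⟩ :=
    hv.exists_generating hdiv hO5 ht (hvr.le.trans hry) hx₃
  obtain ⟨q, hq, hqy, hpq, N, hN⟩ :=
    hp.exists_rank_approx hdiv hO5 hO6 hO7 hpp hpy hx₂₃ hx₃ hxp n
  obtain ⟨q₁, hq₁, hNq₁⟩ := ((hx₀₂.nsmul (n * (N + 1))).trans_le hN).exists_nsmul
  obtain ⟨p₁, hp₁, hpq₁⟩ := hpq.exists_between
  obtain ⟨w₁, hpw₁, hqw₁, hw₁⟩ := hpq₁.exists_common hq₁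
  have hpw : WayBelow p' w₁ := hp₁.trans_le hpw₁
  refine ⟨w₁, ⟨q, hq, hw₁, .le_trans hqy hy⟩,
    .le_trans ((CuSemigroup.le_add_right w t).trans hwp) hpw, ⟨t, hwp.trans hpw.le, hwt⟩, ?_, N,
    hNq₁.trans (nsmul_le_nsmul_right hqw₁ _)⟩
  exact (hx₀₂.le.trans hx₂₃.le).trans (le_infty_trans hxp (hpw.le.trans (le_infty w₁)))

lemma CuFunctional.map_nsmul (lam : CuFunctional S) (n : ℕ) (a : S) :
    lam.toFun (n • a) = n * lam.toFun a := by
  induction n with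
  | zero => simp [lam.map_zero]
  | succ n ih => rw [succ_nsmul, lam.map_add, ih, Nat.cast_succ, add_mul, one_mul]

end Auxiliary

/-- In a (2,ω)-divisible Cu-semigroup satisfying (O5)-(O7), for
`x ∈ S` and `u' ∈ L_x` there is a strongly soft `w` with `u' ≪ w ≤ x ≤ ∞w` and
`λ(w) = λ(x)` for every functional `λ`. -/
theorem exists_soft_same_rank {S : Type*} [CuSemigroup S]
    (hdiv : TwoOmegaDivisible S)
    (hO5 : SatisfiesO5 S) (hO6 : SatisfiesO6 S) (hO7 : SatisfiesO7 S)
    (x : S) {u' : S} (hu' : u' ∈ Lset x) :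
    ∃ w : S, StronglySoft w ∧ WayBelow u' w ∧ w ≤ x ∧ x ≤ infty w ∧
      ∀ lam : CuFunctional S, lam.toFun w = lam.toFun x := by
  obtain ⟨z, hz, hzx, hs⟩ := CuSemigroup.exists_seq x
  choose f hfL hfw hft hfx hfN using fun (n : ℕ) (w : Lset x) =>
    exists_mem_Lset_rank_approx hdiv hO5 hO6 hO7 w.2 (hzx n) n
  let g : ℕ → Lset x := fun n => Nat.rec ⟨u', hu'⟩ (fun n w => ⟨f n w, hfL n w⟩) n
  have hwb (n : ℕ) : WayBelow (g n).1 (g (n + 1)).1 := hfw n (g n)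
  have hmono : Monotone fun n => (g n).1 := monotone_nat_of_le_succ fun n => (hwb n).le
  obtain ⟨w, hw⟩ := CuSemigroup.O1 _ hmono
  have hgw : ∀ n, (g n).1 ≤ w := fun n => hw.1 ⟨n, rfl⟩
  have hwx : w ≤ x := by
    refine hw.2 ?_
    rintro _ ⟨n, rfl⟩
    obtain ⟨u, -, hu, hux⟩ := (g n).2
    exact hu.le.trans hux.le
  refine ⟨w, ?_, (hwb 0).trans_le (hgw 1), hwx, hs.2 ?_, fun lam => le_antisymm
    (lam.mono _ _ hwx) ?_⟩
  · intro a ha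
    obtain ⟨n, hn⟩ := ha _ hmono w hw le_rfl
    obtain ⟨t, ht, hgt⟩ := hft n (g n)
    refine ⟨t, .le_trans ?_ ((hwb (n + 1)).trans_le (hgw (n + 2))), .le_trans hn hgt⟩
    exact (add_le_add_left hn t).trans ht
  · rintro _ ⟨n, rfl⟩
    exact le_infty_trans (hfx n (g n)) ((hgw (n + 1)).trans (le_infty w))
  · rw [lam.map_sup z hz x hs]
    refine iSup_le fun j => ?_
    have key : ∀ n : ℕ, (n : ENNReal) * lam.toFun (z n) ≤ (n + 1) * lam.toFun w := by
      intro n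
      obtain ⟨N, hN⟩ := hfN n (g n)
      have h := lam.mono _ _ (hN.trans (nsmul_le_nsmul_right (hgw (n + 1)) _))
      rw [lam.map_nsmul, lam.map_nsmul] at h
      have hN0 : ((N + 1 : ℕ) : ENNReal) ≠ 0 := by exact_mod_cast N.succ_ne_zero
      rw [← ENNReal.mul_le_mul_iff_right hN0 (ENNReal.natCast_ne_top _)]
      calc _ = ((n * (N + 1) : ℕ) : ENNReal) * lam.toFun (z n) := by push_cast; ring
        _ ≤ _ := h
        _ = _ := by push_cast; ring
    by_cases htop : lam.toFun w = ⊤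
    · simp [htop]
    have hj : ∀ n : ℕ, j ≤ n →
        (n : ENNReal) * lam.toFun (z j) ≤ n * lam.toFun w + lam.toFun w := fun n hn => by
      calc (n : ENNReal) * lam.toFun (z j) ≤ n * lam.toFun (z n) := by
            gcongr
            exact lam.mono _ _ (hz hn)
        _ ≤ (n + 1) * lam.toFun w := key n
        _ = _ := by ring
    refine ENNReal.le_of_forall_pos_le_add fun ε hε _ => ?_
    obtain ⟨n, hn⟩ := ENNReal.exists_nat_mul_gt (a := (ε : ENNReal)) (b := lam.toFun w)
      (by exact_mod_cast hε.ne') htop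
    set k : ℕ := max (j + 1) n with hk
    have hk0 : (k : ENNReal) ≠ 0 := by
      have : k ≠ 0 := by omega
      exact_mod_cast this
    rw [← ENNReal.mul_le_mul_iff_right hk0 (ENNReal.natCast_ne_top _), mul_add]
    refine (hj k (by omega)).trans (add_le_add_right (hn.le.trans ?_) _)
    gcongr
    exact le_max_right _ _
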